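/- arXiv:2010.07992 — 12 statements merged into one kernel-verified Lean document; each statement's English description precedes it below -/
import Mathlib

section
/- Let F be a finite field of odd cardinality q, let g be a positive integer with 2g + 2 > q^2, and assume the characteristic of F does not divide 2g + 2 - q^2. Let P = X^(2g+2-q^2) * (X^q - X)^q + 1 in F[X]. Then P is separable (equivalently, P and its derivative are coprime), and P(a) = 1 for every a in F. -/
open Polynomial

theorem separable_X_pow_mul_pow_add_one {F : Type*} [Field F] {n q : ℕ} (hn : (n : F) ≠ 0)
    (hq : (q : F) = 0) (h : F[X]) : (X ^ n * h ^ q + 1 : F[X]).Separable := by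
  obtain _ | m := n
  · simp at hn
  have hqX : (q : F[X]) = 0 := by rw [← map_natCast C, hq, C_0]
  have hinv : C ((m + 1 : ℕ) : F)⁻¹ * ((m + 1 : ℕ) : F[X]) = 1 := by
    rw [← map_natCast C, ← C_mul, inv_mul_cancel₀ hn, C_1]
  have hder : derivative (X ^ (m + 1) * h ^ q + 1 : F[X])
      = ((m + 1 : ℕ) : F[X]) * X ^ m * h ^ q := by
    simp [derivative_pow, hqX]
  rw [separable_def']
  refine ⟨1, -(C ((m + 1 : ℕ) : F)⁻¹ * X), ?_⟩
  rw [hder]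
  linear_combination (-(X ^ (m + 1) * h ^ q)) * hinv

theorem stmt_0 (F : Type*) [Field F] [Fintype F] (q g : ℕ)
    (hcard : Fintype.card F = q) (hodd : Odd q) (hg : 0 < g)
    (hgq : 2 * g + 2 > q ^ 2)
    (hchar : ¬ ((ringChar F : ℕ) ∣ (2 * g + 2 - q ^ 2))) :
    ((X : F[X]) ^ (2 * g + 2 - q ^ 2) * (X ^ q - X) ^ q + 1).Separable ∧
      ∀ a : F, ((X : F[X]) ^ (2 * g + 2 - q ^ 2) * (X ^ q - X) ^ q + 1).eval a = 1 := by
  subst hcard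
  refine ⟨separable_X_pow_mul_pow_add_one ?_ (FiniteField.cast_card_eq_zero F) _, fun a => ?_⟩
  · rwa [Ne, ringChar.spec]
  · simp [FiniteField.pow_card]
end

section
/- Let F be a finite field of even cardinality q (so F has characteristic 2), and let g be an integer with g >= q - 1. Let Q = (X^q + X) * X^(g+1-q) + 1 and P = (X^q + X)^2 in F[X]. Then Q and (Q')^2 * P + (P')^2 are coprime polynomials (where Q' and P' denote the formal derivatives), and for every a in F one has Q(a) = 1 and P(a) = 0. -/
open Polynomial

/-- In characteristic two with `q` even, the derivative of `(X ^ q + X) * X ^ m + 1` is a monomial. -/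
lemma exists_derivative_eq_X_pow {R : Type*} [CommRing R] [CharP R 2] {q : ℕ} (hq : Even q)
    (m : ℕ) :
    ∃ k : ℕ, derivative ((X ^ q + X) * X ^ m + 1 : R[X]) = X ^ k := by
  have hq0 : (q : R) = 0 := (CharP.cast_eq_zero_iff R 2 q).2 hq.two_dvd
  rcases Nat.even_or_odd m with hm | hm
  · have hm0 : (m : R) = 0 := (CharP.cast_eq_zero_iff R 2 m).2 hm.two_dvd
    exact ⟨m, by simp [derivative_X_pow, hq0, hm0]⟩
  · obtain ⟨j, rfl⟩ := hm
    have h2 : (2 : R[X]) = 0 := CharTwo.two_eq_zero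
    have hm1 : ((2 * j + 1 : ℕ) : R) = 1 := by
      push_cast
      rw [CharTwo.two_eq_zero, zero_mul, zero_add]
    refine ⟨q + 2 * j, ?_⟩
    simp only [derivative_add, derivative_mul, derivative_X_pow, derivative_X, derivative_one,
      hq0, hm1, map_zero, map_one, Nat.add_sub_cancel]
    linear_combination (X ^ (2 * j + 1) : R[X]) * h2

theorem stmt_1 (F : Type*) [Field F] [Fintype F] (q g : ℕ)
    (hcard : Fintype.card F = q) (heven : Even q) (hg : g ≥ q - 1) :
    IsCoprime ((X ^ q + X) * X ^ (g + 1 - q) + 1 : F[X])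
      ((derivative ((X ^ q + X) * X ^ (g + 1 - q) + 1 : F[X])) ^ 2 * ((X ^ q + X) ^ 2)
        + (derivative ((X ^ q + X : F[X]) ^ 2)) ^ 2) ∧
      ∀ a : F, ((X ^ q + X) * X ^ (g + 1 - q) + 1 : F[X]).eval a = 1 ∧
        ((X ^ q + X : F[X]) ^ 2).eval a = 0 := by
  have hchar : ringChar F = 2 :=
    FiniteField.even_card_iff_char_two.2 (by rw [hcard]; exact Nat.even_iff.1 heven)
  have : CharP F 2 := ringChar.of_eq hchar
  have hP : derivative ((X ^ q + X : F[X]) ^ 2) = 0 := by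
    rw [sq, derivative_mul, mul_comm, CharTwo.add_self_eq_zero]
  refine ⟨?_, fun a => ?_⟩
  · obtain ⟨k, hk⟩ := exists_derivative_eq_X_pow (R := F) heven (g + 1 - q)
    rw [hP, hk, zero_pow two_ne_zero, add_zero]
    have hcop : IsCoprime ((X ^ q + X) * X ^ (g + 1 - q) + 1 : F[X]) (X ^ q + X) :=
      ⟨1, -X ^ (g + 1 - q), by ring⟩
    have hX : (X : F[X]) ∣ X ^ q + X :=
      dvd_add (dvd_pow_self X (hcard ▸ Fintype.card_ne_zero)) dvd_rfl
    exact ((hcop.of_isCoprime_of_dvd_right hX).pow_right.pow_right).mul_right hcop.pow_right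
  · have ha : a ^ q + a = 0 := by
      rw [← hcard, FiniteField.pow_card, CharTwo.add_self_eq_zero]
    simp [ha]
end

section
/- Let g >= 2 be an integer with g not congruent to 1 modulo 6, and let P = X^(2g-1) * (X^3 - X) + 1 in (Z/3Z)[X]. Then P is separable (equivalently, P and its derivative are coprime), and P(a) = 1 for every a in Z/3Z. -/
open Polynomial

theorem derivative_X_pow_mul_X_pow_three_sub_X_add_one (m : ℕ) :
    derivative ((X : (ZMod 3)[X]) ^ (2 * m + 1) * (X ^ 3 - X) + 1) =
      X ^ (2 * m + 1) * (C (2 * (m : ZMod 3) + 1) * X ^ 2 - C (2 * (m : ZMod 3) + 2)) := by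
  have h : (X : (ZMod 3)[X]) ^ (2 * m + 1) * (X ^ 3 - X) + 1 =
      X ^ (2 * m + 3 + 1) - X ^ (2 * m + 1 + 1) + 1 := by ring
  have h3 : (3 : (ZMod 3)[X]) = 0 := CharP.cast_eq_zero (ZMod 3)[X] 3
  rw [h]
  simp only [derivative_sub, derivative_X_pow_succ, derivative_one, map_add,
    map_mul, map_natCast, map_ofNat, map_one, Nat.cast_add, Nat.cast_mul, Nat.cast_ofNat]
  linear_combination X ^ (2 * m + 3) * h3

theorem isCoprime_X_pow_mul_add_one (m : ℕ) :
    IsCoprime ((X : (ZMod 3)[X]) ^ (2 * m + 1) * (X ^ 3 - X) + 1) (X ^ (2 * m + 1)) :=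
  ⟨1, -(X ^ 3 - X), by ring⟩

theorem isCoprime_X_sq_add_one {m : ℕ} (hm : Odd m) :
    IsCoprime ((X : (ZMod 3)[X]) ^ (2 * m + 1) * (X ^ 3 - X) + 1) (X ^ 2 + 1) := by
  obtain ⟨k, rfl⟩ := hm
  obtain ⟨q, hq⟩ : (X : (ZMod 3)[X]) ^ 2 + 1 ∣ (X ^ 4) ^ (k + 1) - 1 :=
    (Dvd.intro (X ^ 2 - 1) (by ring)).trans (sub_one_dvd_pow_sub_one (X ^ 4) (k + 1))
  refine ⟨-1, q * (X ^ 2 - 1) + 1, ?_⟩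
  linear_combination -(X ^ 2 - 1) * hq

theorem stmt_2 (g : ℕ) (hg : 2 ≤ g) (hmod : g % 6 ≠ 1) :
    ((X : (ZMod 3)[X]) ^ (2 * g - 1) * (X ^ 3 - X) + 1).Separable ∧
      ∀ a : ZMod 3, ((X : (ZMod 3)[X]) ^ (2 * g - 1) * (X ^ 3 - X) + 1).eval a = 1 := by
  constructor
  · obtain ⟨m, rfl⟩ : ∃ m, g = m + 1 := ⟨g - 1, by omega⟩
    have h3 : (3 : (ZMod 3)[X]) = 0 := CharP.cast_eq_zero (ZMod 3)[X] 3
    rw [show 2 * (m + 1) - 1 = 2 * m + 1 by omega, separable_def,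
      derivative_X_pow_mul_X_pow_three_sub_X_add_one]
    refine (isCoprime_X_pow_mul_add_one m).mul_right ?_
    have hm : (m : ZMod 3) = ((m % 3 : ℕ) : ZMod 3) := (ZMod.natCast_mod m 3).symm
    obtain h | h | h : m % 3 = 0 ∨ m % 3 = 1 ∨ m % 3 = 2 := by omega
    · have hodd : Odd m := Nat.odd_iff.mpr (by omega)
      convert isCoprime_X_sq_add_one hodd using 1
      rw [hm, h]
      simp only [Nat.cast_zero, mul_zero, zero_add, map_one, map_ofNat]
      linear_combination -h3
    · have e : C (2 * (m : ZMod 3) + 1) * X ^ 2 - C (2 * (m : ZMod 3) + 2) = -1 := by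
        rw [hm, h]
        simp only [Nat.cast_one, mul_one, map_add, map_one, map_ofNat]
        linear_combination (X ^ 2 - 1) * h3
      rw [e]
      exact isCoprime_one_right.neg_right
    · have hX : IsCoprime ((X : (ZMod 3)[X]) ^ (2 * m + 1) * (X ^ 3 - X) + 1) (X ^ 2) :=
        ⟨1, -(X ^ (2 * m) * (X ^ 2 - 1)), by ring⟩
      have e : C (2 * (m : ZMod 3) + 1) * X ^ 2 - C (2 * (m : ZMod 3) + 2) = -X ^ 2 := by
        rw [hm, h]
        simp only [Nat.cast_ofNat, map_add, map_mul, map_one, map_ofNat]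
        linear_combination (2 * X ^ 2 - 2) * h3
      rw [e]
      exact hX.neg_right
  · intro a
    have ha : a ^ 3 = a := ZMod.pow_card a
    simp [ha]
end

section
/- Let F_4 = GF(4) and let t in F_4 satisfy t^2 + t + 1 = 0. Let Q = X^3 + (t+1) and P = X^5 + X^2 in F_4[X]. Then Q and (Q')^2 * P + (P')^2 are coprime polynomials (where Q' and P' denote the formal derivatives), and the set {(x,y) in F_4 x F_4 : y^2 + Q(x)*y = P(x)} has exactly 8 elements. -/
open Polynomial

theorem GaloisField.pow_four_eq_self (x : GaloisField 2 2) : x ^ 4 = x := by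
  have : Fintype (GaloisField 2 2) := Fintype.ofFinite _
  have h : Fintype.card (GaloisField 2 2) = 4 := by
    rw [Fintype.card_eq_nat_card, GaloisField.card 2 2 two_ne_zero]
    norm_num
  simpa only [h] using FiniteField.pow_card x

theorem isCoprime_of_sq_add_self_add_one {F : Type*} [Field F] [CharP F 2] (t : F)
    (ht : t ^ 2 + t + 1 = 0) :
    IsCoprime ((X : F[X]) ^ 3 + C (t + 1))
      ((derivative ((X : F[X]) ^ 3 + C (t + 1))) ^ 2 * ((X : F[X]) ^ 5 + X ^ 2)
        + (derivative ((X : F[X]) ^ 5 + X ^ 2)) ^ 2) := by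
  have hT : (C t : F[X]) ^ 2 + C t + 1 = 0 := by
    rw [← C_pow, ← C_add, ← C_1, ← C_add, ht, C_0]
  have h2 : (2 : F[X]) = 0 := CharTwo.two_eq_zero
  have hQ : derivative ((X : F[X]) ^ 3 + C (t + 1)) = X ^ 2 := by
    simp only [derivative_add, derivative_X_pow, derivative_C, Nat.cast_ofNat, C_ofNat]
    linear_combination X ^ 2 * h2
  have hP : derivative ((X : F[X]) ^ 5 + X ^ 2) = X ^ 4 := by
    simp only [derivative_add, derivative_X_pow, Nat.cast_ofNat, C_ofNat]
    linear_combination (2 * X ^ 4 + X) * h2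
  rw [hQ, hP, C_add, C_1]
  generalize (C t : F[X]) = T at hT
  generalize (X : F[X]) = x
  refine ⟨T ^ 2 * (x + T) + (1 + T ^ 2 * x * (x + T)) * T ^ 2 *
    (x ^ 6 + (T + 1) * x ^ 3 + (T + 1) ^ 2 + (x ^ 2 + 1) * (x ^ 3 + (T + 1))),
    (1 + T ^ 2 * x * (x + T)) * T ^ 2, ?_⟩
  grind

theorem stmt_3 (t : GaloisField 2 2) (ht : t ^ 2 + t + 1 = 0) :
    IsCoprime ((X : (GaloisField 2 2)[X]) ^ 3 + C (t + 1))
      ((derivative ((X : (GaloisField 2 2)[X]) ^ 3 + C (t + 1))) ^ 2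
          * ((X : (GaloisField 2 2)[X]) ^ 5 + X ^ 2)
        + (derivative ((X : (GaloisField 2 2)[X]) ^ 5 + X ^ 2)) ^ 2) ∧
      Nat.card {p : GaloisField 2 2 × GaloisField 2 2 //
        p.2 ^ 2 + (p.1 ^ 3 + (t + 1)) * p.2 = p.1 ^ 5 + p.1 ^ 2} = 8 := by
  refine ⟨isCoprime_of_sq_add_self_add_one t ht, ?_⟩
  have h2 : (2 : GaloisField 2 2) = 0 := CharTwo.two_eq_zero
  have hQ (x : GaloisField 2 2) : x ^ 3 + (t + 1) ≠ 0 := by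
    have hx := GaloisField.pow_four_eq_self x
    intro h
    have : x = 0 ∨ x ^ 3 = 1 := by
      have : x * (x ^ 3 - 1) = 0 := by linear_combination hx
      simpa [sub_eq_zero] using this
    grind
  have hP (x : GaloisField 2 2) : x ^ 5 + x ^ 2 = 0 := by
    linear_combination x * GaloisField.pow_four_eq_self x + x ^ 2 * h2
  let f : GaloisField 2 2 × Bool → {p : GaloisField 2 2 × GaloisField 2 2 //
      p.2 ^ 2 + (p.1 ^ 3 + (t + 1)) * p.2 = p.1 ^ 5 + p.1 ^ 2} := fun p =>
    ⟨(p.1, bif p.2 then p.1 ^ 3 + (t + 1) else 0), by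
      rw [hP]
      cases p.2
      · simp
      · simp only [cond_true]
        linear_combination (p.1 ^ 3 + (t + 1)) ^ 2 * h2⟩
  have hf : f.Bijective := by
    constructor
    · rintro ⟨x, b⟩ ⟨y, c⟩ h
      obtain ⟨rfl, h⟩ := Prod.mk.inj (Subtype.mk.inj h)
      cases b <;> cases c
      · rfl
      · exact absurd h.symm (hQ x)
      · exact absurd h (hQ x)
      · rfl
    · rintro ⟨⟨x, y⟩, h⟩
      have hy : y = 0 ∨ y = x ^ 3 + (t + 1) := by
        have : y * (y - (x ^ 3 + (t + 1))) = 0 := by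
          linear_combination h + hP x - (x ^ 3 + (t + 1)) * y * h2
        simpa [sub_eq_zero] using this
      rcases hy with rfl | rfl
      · exact ⟨(x, false), rfl⟩
      · exact ⟨(x, true), rfl⟩
  rw [← Nat.card_eq_of_bijective f hf, Nat.card_prod, GaloisField.card 2 2 two_ne_zero]
  simp
end

section
/- Let F_4 = GF(4). The set of nonzero triples (x,y,z) in F_4^3 satisfying (x + y + z)^4 + (x*y + x*z + y*z)^2 + x*y*z*(x + y + z) = 0 has exactly 42 elements (equivalently, this projective plane quartic over F_4 has exactly 14 rational points). -/
instance : Fact (∀ r : ZMod 2, r ^ 2 ≠ 1 + 1 * r) := ⟨by decide⟩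

theorem natCard_quadraticAlgebra_zmod_two :
    Nat.card (QuadraticAlgebra (ZMod 2) 1 1) = 2 ^ 2 := by
  rw [Nat.card_congr (QuadraticAlgebra.equivProd (1 : ZMod 2) 1)]
  simp

/-- The number of nonzero zeros of Serre's quartic form is invariant under ring isomorphism. -/
theorem natCard_serre_quartic_congr {R S : Type*} [CommRing R] [CommRing S] (e : R ≃+* S) :
    Nat.card {v : R × R × R // v ≠ 0 ∧
      (v.1 + v.2.1 + v.2.2) ^ 4 + (v.1 * v.2.1 + v.1 * v.2.2 + v.2.1 * v.2.2) ^ 2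
        + v.1 * v.2.1 * v.2.2 * (v.1 + v.2.1 + v.2.2) = 0} =
    Nat.card {v : S × S × S // v ≠ 0 ∧
      (v.1 + v.2.1 + v.2.2) ^ 4 + (v.1 * v.2.1 + v.1 * v.2.2 + v.2.1 * v.2.2) ^ 2
        + v.1 * v.2.1 * v.2.2 * (v.1 + v.2.1 + v.2.2) = 0} := by
  refine Nat.card_congr ((e.toEquiv.prodCongr (e.toEquiv.prodCongr e.toEquiv)).subtypeEquiv ?_)
  rintro ⟨x, y, z⟩
  refine and_congr ?_ ?_
  · simp [Prod.ext_iff]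
  · rw [← map_eq_zero_iff e e.injective]
    simp

theorem natCard_serre_quartic_quadraticAlgebra :
    Nat.card {v : QuadraticAlgebra (ZMod 2) 1 1 × QuadraticAlgebra (ZMod 2) 1 1 ×
        QuadraticAlgebra (ZMod 2) 1 1 // v ≠ 0 ∧
      (v.1 + v.2.1 + v.2.2) ^ 4 + (v.1 * v.2.1 + v.1 * v.2.2 + v.2.1 * v.2.2) ^ 2
        + v.1 * v.2.1 * v.2.2 * (v.1 + v.2.1 + v.2.2) = 0} = 42 := by
  let _ : Fintype (QuadraticAlgebra (ZMod 2) 1 1) :=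
    Fintype.ofEquiv _ (QuadraticAlgebra.equivProd (1 : ZMod 2) 1).symm
  rw [Nat.card_eq_fintype_card]
  decide +kernel

theorem stmt_5 :
    Nat.card {v : GaloisField 2 2 × GaloisField 2 2 × GaloisField 2 2 // v ≠ 0 ∧
      (v.1 + v.2.1 + v.2.2) ^ 4 + (v.1 * v.2.1 + v.1 * v.2.2 + v.2.1 * v.2.2) ^ 2
        + v.1 * v.2.1 * v.2.2 * (v.1 + v.2.1 + v.2.2) = 0} = 42 := by
  have : Finite (QuadraticAlgebra (ZMod 2) 1 1) :=
    Finite.of_equiv _ (QuadraticAlgebra.equivProd (1 : ZMod 2) 1).symm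
  have e := GaloisField.algEquivGaloisField 2 2 natCard_quadraticAlgebra_zmod_two
  rw [← natCard_serre_quartic_congr e.toRingEquiv]
  exact natCard_serre_quartic_quadraticAlgebra
end

section
/- Let F_4 = GF(4) and let t in F_4 satisfy t^2 + t + 1 = 0. The only triple (x,y,z) in F_4^3 satisfying (x^2 + x*z)^2 + t*(x^2 + x*z)*(y^2 + y*z) + (y^2 + y*z)^2 + t^2*z^4 = 0 is (0,0,0). Equivalently, this projective plane quartic over F_4 has no rational point. -/
theorem GaloisField.pow_three_eq_one {a : GaloisField 2 2} (ha : a ≠ 0) : a ^ 3 = 1 := by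
  let : Fintype (GaloisField 2 2) := Fintype.ofFinite _
  have h := FiniteField.pow_card_sub_one_eq_one a ha
  rwa [← Nat.card_eq_fintype_card, GaloisField.card 2 2 two_ne_zero] at h

/-- In characteristic two, `x ^ 2 + x * z` takes only the values `0` and `z ^ 2` when
`x` and `z` are elements of the field with four elements and `z ≠ 0`. -/
theorem GaloisField.sq_add_mul_eq_zero_or {x z : GaloisField 2 2} (hz : z ≠ 0) :
    x ^ 2 + x * z = 0 ∨ x ^ 2 + x * z = z ^ 2 := by
  have h2 : (2 : GaloisField 2 2) = 0 := CharTwo.two_eq_zero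
  have hz3 := GaloisField.pow_three_eq_one hz
  have hx : x ^ 4 = x := by
    by_cases hx : x = 0
    · simp [hx]
    · linear_combination x * GaloisField.pow_three_eq_one hx
  have h : (x ^ 2 + x * z) * (x ^ 2 + x * z - z ^ 2) = 0 := by
    linear_combination hx - x * hz3 + x ^ 3 * z * h2
  rcases mul_eq_zero.mp h with h | h
  · exact Or.inl h
  · exact Or.inr (sub_eq_zero.mp h)

theorem GaloisField.eq_zero_of_sq_add_mul_add_sq {t a b : GaloisField 2 2}
    (ht : t ^ 2 + t + 1 = 0) (h : a ^ 2 + t * a * b + b ^ 2 = 0) : a = 0 ∧ b = 0 := by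
  have h2 : (2 : GaloisField 2 2) = 0 := CharTwo.two_eq_zero
  by_cases ha : a = 0
  · subst ha
    simpa using h
  by_cases hb : b = 0
  · subst hb
    simpa using h
  have ha3 := GaloisField.pow_three_eq_one ha
  have hb3 := GaloisField.pow_three_eq_one hb
  by_cases hab : a + b = 0
  · grind
  · have hab3 := GaloisField.pow_three_eq_one hab
    grind

theorem stmt_7 (t : GaloisField 2 2) (ht : t ^ 2 + t + 1 = 0)
    (x y z : GaloisField 2 2)
    (h : (x ^ 2 + x * z) ^ 2 + t * (x ^ 2 + x * z) * (y ^ 2 + y * z)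
        + (y ^ 2 + y * z) ^ 2 + t ^ 2 * z ^ 4 = 0) :
    x = 0 ∧ y = 0 ∧ z = 0 := by
  have h2 : (2 : GaloisField 2 2) = 0 := CharTwo.two_eq_zero
  by_cases hz : z = 0
  · subst hz
    obtain ⟨hx, hy⟩ := GaloisField.eq_zero_of_sq_add_mul_add_sq (a := x ^ 2) (b := y ^ 2) ht
      (by linear_combination h)
    exact ⟨pow_eq_zero_iff two_ne_zero |>.mp hx, pow_eq_zero_iff two_ne_zero |>.mp hy, rfl⟩
  · have hz3 := GaloisField.pow_three_eq_one hz
    rcases GaloisField.sq_add_mul_eq_zero_or (x := x) hz with hx | hx <;>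
      rcases GaloisField.sq_add_mul_eq_zero_or (x := y) hz with hy | hy <;>
      rw [hx, hy] at h <;> clear hx hy <;> grind
end

section
/- Let F_9 = GF(9) be the field with 9 elements. The only quadruple (x,y,z,w) in F_9^4 satisfying both x*y + z^2 + w^2 = 0 and x^3 + y^3 + y^2*z + x^2*w + x*y*w - y^2*w - y*z*w + z^2*w = 0 is (0,0,0,0). Equivalently, the intersection of these two surfaces in P^3 has no F_9-rational point. -/
theorem no_common_zero_quadraticAlgebra :
    ∀ a b c d e f g h : ZMod 3,
      let x : QuadraticAlgebra (ZMod 3) (-1) 0 := ⟨a, b⟩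
      let y : QuadraticAlgebra (ZMod 3) (-1) 0 := ⟨c, d⟩
      let z : QuadraticAlgebra (ZMod 3) (-1) 0 := ⟨e, f⟩
      let w : QuadraticAlgebra (ZMod 3) (-1) 0 := ⟨g, h⟩
      x * y + z ^ 2 + w ^ 2 = 0 →
      x ^ 3 + y ^ 3 + y ^ 2 * z + x ^ 2 * w + x * y * w - y ^ 2 * w
        - y * z * w + z ^ 2 * w = 0 →
      x = 0 ∧ y = 0 ∧ z = 0 ∧ w = 0 := by
  decide +kernel

theorem exists_bijective_ringHom_galoisField :
    ∃ φ : QuadraticAlgebra (ZMod 3) (-1) 0 →+* GaloisField 3 2, Function.Bijective φ := by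
  have : Fintype (GaloisField 3 2) := Fintype.ofFinite _
  have hcard : Nat.card (GaloisField 3 2) = 9 := GaloisField.card 3 2 (by norm_num)
  obtain ⟨i, hi⟩ : IsSquare (-1 : GaloisField 3 2) := by
    rw [FiniteField.isSquare_neg_one_iff, ← Nat.card_eq_fintype_card, hcard]
    norm_num
  let φ : QuadraticAlgebra (ZMod 3) (-1) 0 →ₐ[ZMod 3] GaloisField 3 2 :=
    QuadraticAlgebra.lift ⟨i, by simp [← hi]⟩
  have hinj : Function.Injective φ := by
    rw [injective_iff_map_eq_zero]
    intro u hu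
    have hnorm : ∀ a b : ZMod 3,
        (⟨a, b⟩ * ⟨a, -b⟩ : QuadraticAlgebra (ZMod 3) (-1) 0) = ⟨a ^ 2 + b ^ 2, 0⟩ := by decide
    have hzero : ∀ a b : ZMod 3, a ^ 2 + b ^ 2 = 0 → a = 0 ∧ b = 0 := by decide
    obtain ⟨a, b⟩ := u
    have h := congrArg φ (hnorm a b)
    rw [map_mul, hu, zero_mul] at h
    have h' : φ (algebraMap (ZMod 3) _ (a ^ 2 + b ^ 2)) = 0 := h.symm
    rw [AlgHom.commutes, map_eq_zero] at h'
    obtain ⟨rfl, rfl⟩ := hzero a b h'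
    rfl
  refine ⟨φ, (Nat.bijective_iff_injective_and_card φ).2 ⟨hinj, ?_⟩⟩
  rw [hcard, Nat.card_congr (QuadraticAlgebra.equivProd (-1 : ZMod 3) 0)]
  simp

theorem stmt_9 (x y z w : GaloisField 3 2)
    (h1 : x * y + z ^ 2 + w ^ 2 = 0)
    (h2 : x ^ 3 + y ^ 3 + y ^ 2 * z + x ^ 2 * w + x * y * w - y ^ 2 * w
        - y * z * w + z ^ 2 * w = 0) :
    x = 0 ∧ y = 0 ∧ z = 0 ∧ w = 0 := by
  obtain ⟨φ, hinj, hsurj⟩ := exists_bijective_ringHom_galoisField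
  obtain ⟨⟨a, b⟩, rfl⟩ := hsurj x
  obtain ⟨⟨c, d⟩, rfl⟩ := hsurj y
  obtain ⟨⟨e, f⟩, rfl⟩ := hsurj z
  obtain ⟨⟨g, h⟩, rfl⟩ := hsurj w
  simp only [← map_mul, ← map_pow, ← map_add, ← map_sub, map_eq_zero_iff φ hinj] at h1 h2 ⊢
  exact no_common_zero_quadraticAlgebra a b c d e f g h h1 h2
end

section
/- Let F_4 = GF(4) and let t in F_4 satisfy t^2 + t + 1 = 0. The set of nonzero quadruples (x,y,z,w) in F_4^4 satisfying both x*y + z^2 = 0 and x^3 + x*y*z + t*y^2*w + (t+1)*y*w^2 + w^3 = 0 has exactly 45 elements (equivalently, this intersection of a quadric and a cubic surface in P^3 over F_4 has exactly 15 rational points). -/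
/-- Multiplication of coordinate vectors with respect to the basis `1, t` of the field with four
elements, where `t ^ 2 + t + 1 = 0`. -/
def coordMul (a b : ZMod 2 × ZMod 2) : ZMod 2 × ZMod 2 :=
  (a.1 * b.1 + a.2 * b.2, a.1 * b.2 + a.2 * b.1 + a.2 * b.2)

theorem exists_coordMul_eq_one : ∀ a : ZMod 2 × ZMod 2, a ≠ 0 → ∃ b, coordMul a b = (1, 0) := by
  unfold coordMul
  decide

/-- The element of a field of characteristic two with given coordinates with respect to `1, t`. -/
def ofCoord {K : Type*} [Field K] [CharP K 2] (t : K) (a : ZMod 2 × ZMod 2) : K :=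
  ZMod.castHom (dvd_refl 2) K a.1 + ZMod.castHom (dvd_refl 2) K a.2 * t

section ofCoord

variable {K : Type*} [Field K] [CharP K 2] (t : K)

theorem ofCoord_add (a b : ZMod 2 × ZMod 2) : ofCoord t (a + b) = ofCoord t a + ofCoord t b := by
  simp only [ofCoord, Prod.fst_add, Prod.snd_add, map_add]
  ring

theorem ofCoord_zero : ofCoord t 0 = 0 := by
  simp [ofCoord]

theorem ofCoord_coordMul (ht : t ^ 2 + t + 1 = 0) (a b : ZMod 2 × ZMod 2) :
    ofCoord t (coordMul a b) = ofCoord t a * ofCoord t b := by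
  have h2 : (2 : K) = 0 := CharTwo.two_eq_zero
  simp only [ofCoord, coordMul, map_add, map_mul]
  generalize ZMod.castHom (dvd_refl 2) K a.1 = p, ZMod.castHom (dvd_refl 2) K a.2 = q,
    ZMod.castHom (dvd_refl 2) K b.1 = r, ZMod.castHom (dvd_refl 2) K b.2 = s
  linear_combination (-q * s) * ht + (q * s + q * s * t) * h2

theorem ofCoord_injective (ht : t ^ 2 + t + 1 = 0) : Function.Injective (ofCoord t) := by
  have h2 : (2 : K) = 0 := CharTwo.two_eq_zero
  have h0 : ∀ a, ofCoord t a = 0 → a = 0 := by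
    intro a ha
    by_contra hne
    obtain ⟨b, hb⟩ := exists_coordMul_eq_one a hne
    have h := ofCoord_coordMul t ht a b
    rw [hb, ha, zero_mul] at h
    simp [ofCoord] at h
  intro a b hab
  have h : ofCoord t (a + b) = 0 := by
    rw [ofCoord_add, hab]
    exact CharTwo.add_self_eq_zero _
  exact CharTwo.add_eq_zero.1 (h0 _ h)

theorem ofCoord_bijective (ht : t ^ 2 + t + 1 = 0) (hK : Nat.card K = 4) :
    Function.Bijective (ofCoord t) := by
  have : Finite K := Nat.finite_of_card_ne_zero (by omega)
  refine (Nat.bijective_iff_injective_and_card _).2 ⟨ofCoord_injective t ht, ?_⟩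
  simp [hK]

end ofCoord

theorem card_coord_solutions :
    Fintype.card {v : (ZMod 2 × ZMod 2) × (ZMod 2 × ZMod 2) × (ZMod 2 × ZMod 2) ×
        (ZMod 2 × ZMod 2) //
      v ≠ 0 ∧ coordMul v.1 v.2.1 + coordMul v.2.2.1 v.2.2.1 = 0 ∧
      coordMul (coordMul v.1 v.1) v.1 + coordMul (coordMul v.1 v.2.1) v.2.2.1
        + coordMul (coordMul (0, 1) (coordMul v.2.1 v.2.1)) v.2.2.2
        + coordMul (coordMul (1, 1) v.2.1) (coordMul v.2.2.2 v.2.2.2)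
        + coordMul (coordMul v.2.2.2 v.2.2.2) v.2.2.2 = 0} = 45 := by
  decide +kernel

theorem stmt_10 (t : GaloisField 2 2) (ht : t ^ 2 + t + 1 = 0) :
    Nat.card {v : GaloisField 2 2 × GaloisField 2 2 × GaloisField 2 2 × GaloisField 2 2 //
      v ≠ 0 ∧ v.1 * v.2.1 + v.2.2.1 ^ 2 = 0 ∧
      v.1 ^ 3 + v.1 * v.2.1 * v.2.2.1 + t * v.2.1 ^ 2 * v.2.2.2
        + (t + 1) * v.2.1 * v.2.2.2 ^ 2 + v.2.2.2 ^ 3 = 0} = 45 := by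
  have hcard : Nat.card (GaloisField 2 2) = 4 := by
    rw [GaloisField.card 2 2 two_ne_zero]
    norm_num
  let e := Equiv.ofBijective _ (ofCoord_bijective t ht hcard)
  have he (a) : e a = ofCoord t a := rfl
  have hzero (a) : ofCoord t a = 0 ↔ a = 0 := by
    rw [← ofCoord_zero t, (ofCoord_injective t ht).eq_iff]
  have ht1 : ofCoord t (0, 1) = t := by simp [ofCoord]
  have ht2 : ofCoord t (1, 1) = t + 1 := by simp [ofCoord, add_comm]
  rw [← card_coord_solutions, ← Nat.card_eq_fintype_card]
  refine (Nat.card_congr ((e.prodCongr (e.prodCongr (e.prodCongr e))).subtypeEquiv ?_)).symm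
  rintro ⟨x, y, z, w⟩
  simp only [Equiv.prodCongr_apply, Prod.map_apply, he, ne_eq, Prod.mk_eq_zero, hzero]
  simp only [← hzero (coordMul _ _ + _), ← hzero (_ + coordMul _ _), ofCoord_add,
    ofCoord_coordMul t ht, ht1, ht2, pow_succ, pow_zero, one_mul]
end

section
/- Let F_4 = GF(4) and let t in F_4 satisfy t^2 + t + 1 = 0. The set of nonzero quadruples (x,y,z,w) in F_4^4 satisfying both x*y + z^2 + t*z*w + w^2 = 0 and y^2*z + x*z^2 + x^2*w + y^2*w + y*z*w + z^2*w + x*w^2 + y*w^2 = 0 has exactly 39 elements (equivalently, this intersection of a quadric and a cubic surface in P^3 over F_4 has exactly 13 rational points). -/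
/-- The nonzero zeros in `R⁴` of the quadric and the cubic cutting out the curve. -/
def IsCurveVector {R : Type*} [CommRing R] (t : R) (v : R × R × R × R) : Prop :=
  v ≠ 0 ∧ v.1 * v.2.1 + v.2.2.1 ^ 2 + t * v.2.2.1 * v.2.2.2 + v.2.2.2 ^ 2 = 0 ∧
    v.2.1 ^ 2 * v.2.2.1 + v.1 * v.2.2.1 ^ 2 + v.1 ^ 2 * v.2.2.2 + v.2.1 ^ 2 * v.2.2.2
      + v.2.1 * v.2.2.1 * v.2.2.2 + v.2.2.1 ^ 2 * v.2.2.2 + v.1 * v.2.2.2 ^ 2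
      + v.2.1 * v.2.2.2 ^ 2 = 0

instance {R : Type*} [CommRing R] [DecidableEq R] (t : R) : DecidablePred (IsCurveVector t) :=
  fun _ => inferInstanceAs (Decidable (_ ∧ _ ∧ _))

theorem isCurveVector_map {R S : Type*} [CommRing R] [CommRing S] (e : R ≃+* S) (t : R)
    (v : R × R × R × R) :
    IsCurveVector t v ↔ IsCurveVector (e t) (e v.1, e v.2.1, e v.2.2.1, e v.2.2.2) := by
  obtain ⟨x, y, z, w⟩ := v
  simp only [IsCurveVector, ne_eq, Prod.mk_eq_zero, ← map_mul, ← map_pow, ← map_add,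
    EmbeddingLike.map_eq_zero_iff]

theorem card_isCurveVector_congr {R S : Type*} [CommRing R] [CommRing S] (e : R ≃+* S) (t : R) :
    Nat.card {v // IsCurveVector t v} = Nat.card {v // IsCurveVector (e t) v} :=
  Nat.card_congr <| Equiv.subtypeEquiv
    (e.toEquiv.prodCongr (e.toEquiv.prodCongr (e.toEquiv.prodCongr e.toEquiv)))
    (isCurveVector_map e t)

/-- A computable model of the field with four elements. -/
abbrev FourElementField : Type := QuadraticAlgebra (ZMod 2) 1 1

instance : Fintype FourElementField := Fintype.ofEquiv _ (QuadraticAlgebra.equivProd 1 1).symm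

theorem card_isCurveVector_omega :
    Nat.card {v // IsCurveVector (QuadraticAlgebra.omega : FourElementField) v} = 39 := by
  rw [Nat.card_eq_fintype_card]
  decide +kernel

theorem exists_ringEquiv_omega (t : GaloisField 2 2) (ht : t ^ 2 + t + 1 = 0) :
    ∃ e : FourElementField ≃+* GaloisField 2 2, e QuadraticAlgebra.omega = t := by
  have h : t * t = (1 : ZMod 2) • (1 : GaloisField 2 2) + (1 : ZMod 2) • t := by
    rw [one_smul, one_smul]
    linear_combination ht - (t + 1) * CharTwo.two_eq_zero (R := GaloisField 2 2)
  let f : FourElementField →ₐ[ZMod 2] GaloisField 2 2 := QuadraticAlgebra.lift ⟨t, h⟩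
  have hf : Function.Bijective f := by
    refine (Nat.bijective_iff_injective_and_card _).2 ⟨f.toRingHom.injective, ?_⟩
    rw [GaloisField.card 2 2 two_ne_zero, Nat.card_eq_fintype_card]
    rfl
  exact ⟨RingEquiv.ofBijective f hf, by simp [f]⟩

theorem stmt_11 (t : GaloisField 2 2) (ht : t ^ 2 + t + 1 = 0) :
    Nat.card {v : GaloisField 2 2 × GaloisField 2 2 × GaloisField 2 2 × GaloisField 2 2 //
      v ≠ 0 ∧ v.1 * v.2.1 + v.2.2.1 ^ 2 + t * v.2.2.1 * v.2.2.2 + v.2.2.2 ^ 2 = 0 ∧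
      v.2.1 ^ 2 * v.2.2.1 + v.1 * v.2.2.1 ^ 2 + v.1 ^ 2 * v.2.2.2 + v.2.1 ^ 2 * v.2.2.2
        + v.2.1 * v.2.2.1 * v.2.2.2 + v.2.2.1 ^ 2 * v.2.2.2 + v.1 * v.2.2.2 ^ 2
        + v.2.1 * v.2.2.2 ^ 2 = 0} = 39 := by
  obtain ⟨e, rfl⟩ := exists_ringEquiv_omega t ht
  exact (card_isCurveVector_congr e _).symm.trans card_isCurveVector_omega
end

section
/- Let F_4 = GF(4) and let t in F_4 satisfy t^2 + t + 1 = 0. The set of nonzero triples (x,y,z) in F_4^3 satisfying (t+1)*x^3*y^2 + x^2*y^3 + t*x*y^4 + t*x^4*z + t*x^3*y*z + t*x^2*y^2*z + x*y^3*z + t*y^4*z + (t+1)*x^3*z^2 + (t+1)*x^2*y*z^2 + y^3*z^2 + x^2*z^3 = 0 has exactly 45 elements (equivalently, this projective plane quintic over F_4 passes through exactly 15 rational points of the projective plane). -/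
/-- The polynomial ring quotient `F₂[ω]/(ω² + ω + 1)`, a computable model of the field with four
elements. -/
abbrev F4Model : Type := QuadraticAlgebra (ZMod 2) 1 1

instance : Fintype F4Model := Fintype.ofEquiv _ (QuadraticAlgebra.equivProd 1 1).symm

theorem exists_ringEquiv_F4Model (t : GaloisField 2 2) (ht : t ^ 2 + t + 1 = 0) :
    ∃ e : F4Model ≃+* GaloisField 2 2, e QuadraticAlgebra.omega = t := by
  have h : t * t = (1 : ZMod 2) • 1 + (1 : ZMod 2) • t := by
    rw [one_smul, one_smul]
    linear_combination ht - (t + 1) * CharTwo.two_eq_zero (R := GaloisField 2 2)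
  let f : F4Model →ₐ[ZMod 2] GaloisField 2 2 := QuadraticAlgebra.lift ⟨t, h⟩
  have hcard : Nat.card F4Model = Nat.card (GaloisField 2 2) := by
    rw [GaloisField.card 2 2 (by decide), Nat.card_congr (QuadraticAlgebra.equivProd 1 1)]
    simp
  have hbij : Function.Bijective f :=
    (Nat.bijective_iff_injective_and_card f).2 ⟨f.toRingHom.injective, hcard⟩
  exact ⟨RingEquiv.ofBijective f hbij, by simp [f]⟩

open scoped QuadraticAlgebra in
theorem card_quintic_F4Model :
    Fintype.card {v : F4Model × F4Model × F4Model // v ≠ 0 ∧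
      (ω + 1) * v.1 ^ 3 * v.2.1 ^ 2 + v.1 ^ 2 * v.2.1 ^ 3 + ω * v.1 * v.2.1 ^ 4
        + ω * v.1 ^ 4 * v.2.2 + ω * v.1 ^ 3 * v.2.1 * v.2.2
        + ω * v.1 ^ 2 * v.2.1 ^ 2 * v.2.2 + v.1 * v.2.1 ^ 3 * v.2.2
        + ω * v.2.1 ^ 4 * v.2.2 + (ω + 1) * v.1 ^ 3 * v.2.2 ^ 2
        + (ω + 1) * v.1 ^ 2 * v.2.1 * v.2.2 ^ 2 + v.2.1 ^ 3 * v.2.2 ^ 2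
        + v.1 ^ 2 * v.2.2 ^ 3 = 0} = 45 := by
  decide +kernel

theorem stmt_14 (t : GaloisField 2 2) (ht : t ^ 2 + t + 1 = 0) :
    Nat.card {v : GaloisField 2 2 × GaloisField 2 2 × GaloisField 2 2 // v ≠ 0 ∧
      (t + 1) * v.1 ^ 3 * v.2.1 ^ 2 + v.1 ^ 2 * v.2.1 ^ 3 + t * v.1 * v.2.1 ^ 4
        + t * v.1 ^ 4 * v.2.2 + t * v.1 ^ 3 * v.2.1 * v.2.2
        + t * v.1 ^ 2 * v.2.1 ^ 2 * v.2.2 + v.1 * v.2.1 ^ 3 * v.2.2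
        + t * v.2.1 ^ 4 * v.2.2 + (t + 1) * v.1 ^ 3 * v.2.2 ^ 2
        + (t + 1) * v.1 ^ 2 * v.2.1 * v.2.2 ^ 2 + v.2.1 ^ 3 * v.2.2 ^ 2
        + v.1 ^ 2 * v.2.2 ^ 3 = 0} = 45 := by
  obtain ⟨e, rfl⟩ := exists_ringEquiv_F4Model t ht
  rw [← card_quintic_F4Model, ← Nat.card_eq_fintype_card]
  symm
  refine Nat.card_congr ((e.toEquiv.prodCongr (e.toEquiv.prodCongr e.toEquiv)).subtypeEquiv ?_)
  rintro ⟨x, y, z⟩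
  refine and_congr (by simp [Prod.ext_iff]) ?_
  rw [← e.map_eq_zero_iff]
  simp
end

section
/- Let F_4 = GF(4). The set of triples (x,y,z) in F_4^3 satisfying both y^2 + y + x^3 = 0 and z^2 + z + y*x^2 + x*y^2 = 0 has exactly 16 elements. -/
/-- An explicit model of the field with four elements: `F₂[t] / (t² + t + 1)`. -/
abbrev FieldFour : Type := QuadraticAlgebra (ZMod 2) 1 1

namespace FieldFour

instance : Fact (∀ r : ZMod 2, r ^ 2 ≠ 1 + 1 * r) := ⟨by decide⟩

instance : Fintype FieldFour :=
  Fintype.ofEquiv (ZMod 2 × ZMod 2) (QuadraticAlgebra.equivProd 1 1).symm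

theorem card_eq : Fintype.card FieldFour = 4 := by decide

theorem card_points :
    Fintype.card {p : FieldFour × FieldFour × FieldFour //
      p.2.1 ^ 2 + p.2.1 + p.1 ^ 3 = 0 ∧
      p.2.2 ^ 2 + p.2.2 + p.2.1 * p.1 ^ 2 + p.1 * p.2.1 ^ 2 = 0} = 16 := by
  decide

end FieldFour

theorem nonempty_galoisField_ringEquiv_fieldFour :
    Nonempty (GaloisField 2 2 ≃+* FieldFour) := by
  have : Fintype (GaloisField 2 2) := Fintype.ofFinite _
  refine ⟨FiniteField.ringEquivOfCardEq ?_⟩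
  rw [FieldFour.card_eq, ← Nat.card_eq_fintype_card, GaloisField.card 2 2 two_ne_zero]
  norm_num

theorem stmt_16 :
    Nat.card {p : GaloisField 2 2 × GaloisField 2 2 × GaloisField 2 2 //
      p.2.1 ^ 2 + p.2.1 + p.1 ^ 3 = 0 ∧
      p.2.2 ^ 2 + p.2.2 + p.2.1 * p.1 ^ 2 + p.1 * p.2.1 ^ 2 = 0} = 16 := by
  obtain ⟨e⟩ := nonempty_galoisField_ringEquiv_fieldFour
  rw [← FieldFour.card_points, ← Nat.card_eq_fintype_card]
  refine Nat.card_congr ((e.toEquiv.prodCongr (e.toEquiv.prodCongr e.toEquiv)).subtypeEquiv ?_)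
  rintro ⟨x, y, z⟩
  simp [← map_pow, ← map_add, ← map_mul]
end

section
/- Let F_4 = GF(4) and let t in F_4 satisfy t^2 + t + 1 = 0. The set of nonzero quintuples (v,w,x,y,z) in F_4^5 satisfying all three equations v*w + x*y + z^2 = 0, v*z + w*y + x^2 + t*z^2 = 0, and v^2 + v*w + w*z + t*x*y + x*z + y^2 + z^2 = 0 has exactly 15 elements (equivalently, this intersection of three quadric hypersurfaces in P^4 over F_4 has exactly 5 rational points). -/
/-- Addition of pairs `(a, b)` representing `a + b * t` in characteristic two. -/
def bitAdd (x y : Bool × Bool) : Bool × Bool := (xor x.1 y.1, xor x.2 y.2)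

/-- Multiplication of pairs `(a, b)` representing `a + b * t`, where `t ^ 2 = t + 1`. -/
def bitMul (x y : Bool × Bool) : Bool × Bool :=
  (xor (x.1 && y.1) (x.2 && y.2), xor (xor (x.1 && y.2) (x.2 && y.1)) (x.2 && y.2))

/-- The element `a + b * t` represented by the pair `(a, b)`. -/
def bitVal {K : Type*} [Field K] (t : K) (x : Bool × Bool) : K :=
  (if x.1 then 1 else 0) + (if x.2 then t else 0)

section

variable {K : Type*} [Field K] [CharP K 2] {t : K}

theorem bitVal_add (t : K) (x y : Bool × Bool) :
    bitVal t (bitAdd x y) = bitVal t x + bitVal t y := by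
  have h2 : (2 : K) = 0 := CharTwo.two_eq_zero
  obtain ⟨a, b⟩ := x
  obtain ⟨c, d⟩ := y
  cases a <;> cases b <;> cases c <;> cases d <;> simp [bitVal, bitAdd] <;> grind

theorem bitVal_mul (ht : t ^ 2 + t + 1 = 0) (x y : Bool × Bool) :
    bitVal t (bitMul x y) = bitVal t x * bitVal t y := by
  have h2 : (2 : K) = 0 := CharTwo.two_eq_zero
  obtain ⟨a, b⟩ := x
  obtain ⟨c, d⟩ := y
  cases a <;> cases b <;> cases c <;> cases d <;> simp [bitVal, bitMul] <;> grind

theorem bitVal_eq_zero_iff (ht : t ^ 2 + t + 1 = 0) (x : Bool × Bool) :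
    bitVal t x = 0 ↔ x = (false, false) := by
  have h2 : (2 : K) = 0 := CharTwo.two_eq_zero
  obtain ⟨a, b⟩ := x
  cases a <;> cases b <;> simp [bitVal] <;> grind

theorem bitVal_injective (ht : t ^ 2 + t + 1 = 0) : Function.Injective (bitVal t) := by
  intro x y h
  have h0 : bitVal t (bitAdd x y) = 0 := by rw [bitVal_add, h, CharTwo.add_self_eq_zero]
  rw [bitVal_eq_zero_iff ht] at h0
  simpa [bitAdd, Prod.ext_iff] using h0

theorem bitVal_bijective (hK : Nat.card K = 4) (ht : t ^ 2 + t + 1 = 0) :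
    Function.Bijective (bitVal t) := by
  have : Finite K := Nat.finite_of_card_ne_zero (by omega)
  exact (Nat.bijective_iff_injective_and_card _).2 ⟨bitVal_injective ht, by simp [hK]⟩

end

/-- The three quadrics and the nonvanishing condition, on pairs of bits. -/
def BitSolution (p : (Bool × Bool) × (Bool × Bool) × (Bool × Bool) × (Bool × Bool)
    × (Bool × Bool)) : Prop :=
  let v := p.1
  let w := p.2.1
  let x := p.2.2.1
  let y := p.2.2.2.1
  let z := p.2.2.2.2
  let t := (false, true)
  let o := (false, false)
  p ≠ (o, o, o, o, o) ∧
  bitAdd (bitAdd (bitMul v w) (bitMul x y)) (bitMul z z) = o ∧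
  bitAdd (bitAdd (bitAdd (bitMul v z) (bitMul w y)) (bitMul x x)) (bitMul t (bitMul z z)) = o ∧
  bitAdd (bitAdd (bitAdd (bitAdd (bitAdd (bitAdd (bitMul v v) (bitMul v w)) (bitMul w z))
    (bitMul (bitMul t x) y)) (bitMul x z)) (bitMul y y)) (bitMul z z) = o

instance : DecidablePred BitSolution := fun p => by
  unfold BitSolution
  infer_instance

theorem card_bitSolution : Nat.card {p // BitSolution p} = 15 := by
  rw [Nat.card_eq_fintype_card]
  decide +kernel

theorem stmt_18 (t : GaloisField 2 2) (ht : t ^ 2 + t + 1 = 0) :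
    Nat.card {p : GaloisField 2 2 × GaloisField 2 2 × GaloisField 2 2 × GaloisField 2 2
        × GaloisField 2 2 // p ≠ 0 ∧
      p.1 * p.2.1 + p.2.2.1 * p.2.2.2.1 + p.2.2.2.2 ^ 2 = 0 ∧
      p.1 * p.2.2.2.2 + p.2.1 * p.2.2.2.1 + p.2.2.1 ^ 2 + t * p.2.2.2.2 ^ 2 = 0 ∧
      p.1 ^ 2 + p.1 * p.2.1 + p.2.1 * p.2.2.2.2 + t * p.2.2.1 * p.2.2.2.1
        + p.2.2.1 * p.2.2.2.2 + p.2.2.2.1 ^ 2 + p.2.2.2.2 ^ 2 = 0} = 15 := by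
  have hcard : Nat.card (GaloisField 2 2) = 4 := by
    rw [GaloisField.card 2 2 (by norm_num)]
    norm_num
  let e := Equiv.ofBijective (bitVal t) (bitVal_bijective hcard ht)
  have he (x : Bool × Bool) : e x = bitVal t x := rfl
  have ht' : bitVal t (false, true) = t := by simp [bitVal]
  rw [← card_bitSolution]
  refine (Nat.card_congr (Equiv.subtypeEquiv
    (e.prodCongr (e.prodCongr (e.prodCongr (e.prodCongr e)))) fun p => ?_)).symm
  obtain ⟨v, w, x, y, z⟩ := p
  simp only [BitSolution, ← bitVal_eq_zero_iff ht, bitVal_add, bitVal_mul ht, ht',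
    Equiv.prodCongr_apply, Prod.map_apply, he, ne_eq, Prod.mk_eq_zero, Prod.mk.injEq, sq]
end
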